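/- Let K/k be a finite abelian extension of totally real number fields with Galois group G, let F be an intermediate field of K/k with H = Gal(K/F) and Δ = Gal(F/k) ≅ G/H, and let π_F : ℝ[G] → ℝ[Δ] be the ℝ-algebra homomorphism of group rings induced by the restriction map G → Δ. Fix real (infinite) places w_1, …, w_r of K and let w'_1, …, w'_r be their restrictions to F. Then for all u_1, …, u_r ∈ Fˣ one has π_F( det( −Σ_{σ∈G} log|σ(u_i)|_{w_j} · σ^{-1} )_{1≤i,j≤r} ) = |H|^r · det( −Σ_{τ∈Δ} log|τ(u_i)|_{w'_j} · τ^{-1} )_{1≤i,j≤r}, where the first determinant is computed in the r×r matrix ring over the commutative ring ℝ[G] and the second in the r×r matrix ring over ℝ[Δ]. -/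

import Mathlib

open NumberField MonoidAlgebra

theorem aux_fiber {G D : Type*} [Group G] [Group D] [Fintype G] [Fintype D] [DecidableEq D]
    (f : G →* D) (hf : Function.Surjective f) (n : ℕ)
    (hn : Fintype.card D * n = Fintype.card G) (d : D) :
    (Finset.univ.filter fun g => f g = d).card = n := by
  have key : ∀ e : D, (Finset.univ.filter fun g => f g = e).card =
      (Finset.univ.filter fun g => f g = d).card := fun e =>
    MonoidHom.card_fiber_eq_of_mem_range f (hf e) (hf d)
  have h := Finset.card_eq_sum_card_fiberwise (f := f) (s := Finset.univ) (t := Finset.univ)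
    (by intro x _; simp)
  rw [Finset.sum_congr rfl (fun e _ => key e)] at h
  simp only [Finset.sum_const, Finset.card_univ, smul_eq_mul] at h
  rw [← hn] at h
  exact (Nat.eq_of_mul_eq_mul_left Fintype.card_pos h).symm

theorem aux_sum {G D : Type*} [Group G] [Group D] [Fintype G] [Fintype D]
    (f : G →* D) (hf : Function.Surjective f) (n : ℕ)
    (hn : Fintype.card D * n = Fintype.card G) (c : D → ℝ) :
    mapDomainRingHom ℝ f (∑ σ : G, single σ⁻¹ (c (f σ))) =
      (n : MonoidAlgebra ℝ D) * ∑ τ : D, single τ⁻¹ (c τ) := by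
  classical
  rw [map_sum, Finset.mul_sum, ← Finset.sum_fiberwise Finset.univ f]
  refine Finset.sum_congr rfl fun d _ => ?_
  rw [← nsmul_eq_mul, ← aux_fiber f hf n hn d, ← Finset.sum_const]
  refine Finset.sum_congr rfl fun g hg => ?_
  rw [← (Finset.mem_filter.1 hg).2, mapDomainRingHom_apply, mapDomain_single, map_inv]

theorem aux_det {G D : Type*} [CommGroup G] [CommGroup D] [Fintype G] [Fintype D]
    (f : G →* D) (hf : Function.Surjective f) (n : ℕ)
    (hn : Fintype.card D * n = Fintype.card G) (r : ℕ)
    (a : Fin r → Fin r → G → ℝ) (c : Fin r → Fin r → D → ℝ)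
    (hac : ∀ i j g, a i j g = c i j (f g)) :
    mapDomainRingHom ℝ f (Matrix.det (Matrix.of fun i j : Fin r =>
        ∑ σ : G, single σ⁻¹ (a i j σ))) =
      (n : MonoidAlgebra ℝ D) ^ r * Matrix.det (Matrix.of fun i j : Fin r =>
        ∑ τ : D, single τ⁻¹ (c i j τ)) := by
  rw [RingHom.map_det]
  have := Matrix.det_smul (Matrix.of fun i j : Fin r =>
        (∑ τ : D, single τ⁻¹ (c i j τ) : MonoidAlgebra ℝ D)) (n : MonoidAlgebra ℝ D)
  rw [Fintype.card_fin] at this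
  rw [← this]
  congr 1
  ext1 i j
  simp only [RingHom.mapMatrix_apply, Matrix.map_apply, Matrix.of_apply, Matrix.smul_apply,
    smul_eq_mul, hac]
  exact aux_sum f hf n hn (c i j)

/-- Let `K/k` be a finite abelian extension of totally real number fields with
Galois group `G`, `F` an intermediate field, `H = Gal(K/F)`, `Δ = Gal(F/k)`, and
`π_F : ℝ[G] → ℝ[Δ]` the ring homomorphism of group rings induced by restriction `G → Δ`.
Fix real infinite places `w 1, …, w r` of `K`, with restrictions `w' j = (w j).comap` to `F`.
Then for `u 1, …, u r ∈ Fˣ`,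
`π_F (det(−Σ_{σ∈G} log|σ(u i)|_{w j} σ⁻¹)_{i,j}) = |H|^r · det(−Σ_{τ∈Δ} log|τ(u i)|_{w' j} τ⁻¹)_{i,j}`. -/
theorem stmt0
    (k F K : Type*) [Field k] [Field F] [Field K]
    [NumberField k] [NumberField F] [NumberField K]
    [Algebra k F] [Algebra k K] [Algebra F K] [IsScalarTower k F K]
    [IsGalois k K] [FiniteDimensional k K] [Normal k F]
    [FiniteDimensional k F] [FiniteDimensional F K]
    -- the fields are totally real
    (hk : ∀ v : InfinitePlace k, v.IsReal)
    (hK : ∀ v : InfinitePlace K, v.IsReal)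
    -- the extension K/k is abelian (hence so is F/k)
    (hab : ∀ σ τ : K ≃ₐ[k] K, σ * τ = τ * σ)
    (hab' : ∀ σ τ : F ≃ₐ[k] F, σ * τ = τ * σ)
    (r : ℕ) (w : Fin r → InfinitePlace K) (hw : ∀ j, (w j).IsReal)
    (u : Fin r → Fˣ) :
    letI : CommGroup (K ≃ₐ[k] K) :=
      { (inferInstance : Group (K ≃ₐ[k] K)) with mul_comm := hab }
    letI : CommGroup (F ≃ₐ[k] F) :=
      { (inferInstance : Group (F ≃ₐ[k] F)) with mul_comm := hab' }
    mapDomainRingHom ℝ (AlgEquiv.restrictNormalHom (F := k) (K₁ := K) F)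
        (Matrix.det (Matrix.of fun i j : Fin r =>
          ∑ σ : K ≃ₐ[k] K,
            single σ⁻¹ (-Real.log ((w j) (σ (algebraMap F K (u i))))))) =
      (Fintype.card (K ≃ₐ[F] K) : MonoidAlgebra ℝ (F ≃ₐ[k] F)) ^ r *
        Matrix.det (Matrix.of fun i j : Fin r =>
          ∑ τ : F ≃ₐ[k] F,
            single τ⁻¹ (-Real.log (((w j).comap (algebraMap F K)) (τ (u i))))) := by
  let i1 : CommGroup (K ≃ₐ[k] K) :=
      { (inferInstance : Group (K ≃ₐ[k] K)) with mul_comm := hab }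
  let i2 : CommGroup (F ≃ₐ[k] F) :=
      { (inferInstance : Group (F ≃ₐ[k] F)) with mul_comm := hab' }
  have hkF : IsGalois k F := { }
  have hFK : IsGalois F K := IsGalois.tower_top_of_isGalois k F K
  refine @aux_det (K ≃ₐ[k] K) (F ≃ₐ[k] F) i1 i2 _ _
    (AlgEquiv.restrictNormalHom (F := k) (K₁ := K) F)
    (AlgEquiv.restrictNormalHom_surjective K) (Fintype.card (K ≃ₐ[F] K)) ?_ r
    (fun i j σ => -Real.log ((w j) (σ (algebraMap F K (u i)))))
    (fun i j τ => -Real.log (((w j).comap (algebraMap F K)) (τ (u i)))) ?_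
  · simp only [← Nat.card_eq_fintype_card]
    rw [IsGalois.card_aut_eq_finrank, IsGalois.card_aut_eq_finrank,
      IsGalois.card_aut_eq_finrank, Module.finrank_mul_finrank]
  · intro i j σ
    have := AlgEquiv.restrictNormal_commutes σ F (u i)
    simp only [InfinitePlace.comap_apply]
    rw [← this]
    rfl
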